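/- For every n ≥ 2 and every ε with 0 < ε < 1, consider the instance with n agents and 2n−1 items {s_1,…,s_n, b_1,…,b_{n−1}} in which each agent i values s_i at 1+ε, values s_j at 1 − ε/(n−1) for each j ≠ i, and values b_j at n for each 1 ≤ j ≤ n−1. Then in every allocation in which every agent receives at most 2 items, some agent i receives value v_i(A_i) ≤ 2 + ε, even though MMS_i = n for every agent i. -/

import Mathlib

open Finset

/-- The value of a bundle `S` under an additive valuation with item values `v`. -/
def val {ι : Type*} (v : ι → ℝ) (S : Finset ι) : ℝ := ∑ j ∈ S, v j

/-- `A` is an allocation: the bundles are pairwise disjoint and cover all items. -/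
def isAlloc {ι : Type*} [Fintype ι] [DecidableEq ι] {n : ℕ} (A : Fin n → Finset ι) : Prop :=
  (∀ i j : Fin n, i ≠ j → Disjoint (A i) (A j)) ∧ Finset.univ.biUnion A = Finset.univ

/-- `μ` is the maximin share of an agent with valuation `v` among `n` agents:
the maximum over partitions into `n` bundles of the minimum bundle value. -/
def isMMS {ι : Type*} [Fintype ι] [DecidableEq ι] (n : ℕ) (v : ι → ℝ) (μ : ℝ) : Prop :=
  IsGreatest {x : ℝ | ∃ P : Fin n → Finset ι, isAlloc P ∧ x = ⨅ i : Fin n, val v (P i)} μ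

theorem isAlloc_fibers {ι : Type*} [Fintype ι] [DecidableEq ι] {n : ℕ} (f : ι → Fin n) :
    isAlloc (fun i => univ.filter (fun x => f x = i)) := by
  refine ⟨fun i j hij => ?_, ?_⟩
  · rw [Finset.disjoint_left]
    intro x hx hy
    simp only [mem_filter, mem_univ, true_and] at hx hy
    exact hij (hx.symm.trans hy)
  · ext x
    simp

theorem isAlloc.sum_val {ι : Type*} [Fintype ι] [DecidableEq ι] {n : ℕ}
    {A : Fin n → Finset ι} (hA : isAlloc A) (v : ι → ℝ) :
    ∑ i, val v (A i) = ∑ x, v x := by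
  rw [← hA.2, Finset.sum_biUnion fun i _ j _ hij => hA.1 i j hij]
  rfl

/-- Among `n` agents the minimum bundle value is at most the average. -/
theorem isAlloc.mul_iInf_val_le {ι : Type*} [Fintype ι] [DecidableEq ι] {n : ℕ}
    {A : Fin n → Finset ι} (hA : isAlloc A) (v : ι → ℝ) :
    (n : ℝ) * ⨅ i, val v (A i) ≤ ∑ x, v x := by
  rw [← hA.sum_val v]
  have h := Finset.card_nsmul_le_sum univ (fun i => val v (A i)) (⨅ i, val v (A i))
    fun i _ => ciInf_le (Set.finite_range _).bddBelow i
  simpa using h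

/-- A partition into bundles that all have the same value attains the maximin share. -/
theorem isMMS_of_forall_val_eq {ι : Type*} [Fintype ι] [DecidableEq ι] {n : ℕ} (hn : 0 < n)
    {v : ι → ℝ} {μ : ℝ} {P : Fin n → Finset ι} (hP : isAlloc P) (h : ∀ i, val v (P i) = μ) :
    isMMS n v μ := by
  have : Nonempty (Fin n) := ⟨⟨0, hn⟩⟩
  refine ⟨⟨P, hP, by simp [h]⟩, ?_⟩
  rintro x ⟨A, hA, rfl⟩
  have hle := hA.mul_iInf_val_le v
  rw [← hP.sum_val v] at hle
  simp only [h, sum_const, card_univ, Fintype.card_fin, nsmul_eq_mul] at hle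
  exact le_of_mul_le_mul_left hle (by exact_mod_cast hn)

/-- If there are fewer items of the form `Sum.inr` than agents, some agent gets none of them. -/
theorem isAlloc.exists_forall_inr_notMem {α : Type*} [Fintype α] [DecidableEq α] {n k : ℕ}
    (hk : k < n) {A : Fin n → Finset (α ⊕ Fin k)} (hA : isAlloc A) :
    ∃ i, ∀ j, Sum.inr j ∉ A i := by
  by_contra! h
  choose f hf using h
  have hinj : Function.Injective f := by
    intro i j hij
    by_contra hne
    exact Finset.disjoint_left.1 (hA.1 i j hne) (hf i) (hij ▸ hf j)
  have := Fintype.card_le_of_injective f hinj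
  simp only [Fintype.card_fin] at this
  omega

/-- in the instance with `n ≥ 2` agents and `2n−1` items
`{s_1,…,s_n, b_1,…,b_{n−1}}` (small items `Sum.inl`, big items `Sum.inr`),
where agent `i` values `s_i` at `1+ε`, values `s_j` (for `j ≠ i`) at `1 − ε/(n−1)`,
and values each `b_j` at `n`: in every allocation in which every agent receives at
most 2 items, some agent receives value at most `2 + ε`, even though `MMS_i = n`
for every agent `i`. -/
theorem stmt11 (n : ℕ) (hn : 2 ≤ n) (ε : ℝ) (hε0 : 0 < ε) (hε1 : ε < 1)
    (v : Fin n → (Fin n ⊕ Fin (n - 1)) → ℝ)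
    (hvs : ∀ i j : Fin n,
      v i (Sum.inl j) = if j = i then 1 + ε else 1 - ε / ((n : ℝ) - 1))
    (hvb : ∀ (i : Fin n) (j : Fin (n - 1)), v i (Sum.inr j) = (n : ℝ)) :
    (∀ i : Fin n, isMMS n (v i) (n : ℝ)) ∧
    (∀ A : Fin n → Finset (Fin n ⊕ Fin (n - 1)), isAlloc A →
      (∀ i, (A i).card ≤ 2) → ∃ i, val (v i) (A i) ≤ 2 + ε) := by
  have hn1 : (0 : ℝ) < (n : ℝ) - 1 := by
    have : (2 : ℝ) ≤ n := by exact_mod_cast hn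
    linarith
  constructor
  · intro i
    refine isMMS_of_forall_val_eq (by omega)
      (isAlloc_fibers (Sum.elim (fun _ => (⟨n - 1, by omega⟩ : Fin n))
        (Fin.castLE (Nat.sub_le n 1)))) ?_
    intro a
    have hsmall : ∑ j, v i (Sum.inl j) = (n : ℝ) := by
      have hterm : ∀ j, v i (Sum.inl j) = (1 - ε / ((n : ℝ) - 1)) +
          if j = i then ε + ε / ((n : ℝ) - 1) else 0 := by
        intro j
        rw [hvs]
        split_ifs <;> ring
      simp only [hterm, sum_add_distrib, sum_const, card_univ, Fintype.card_fin, nsmul_eq_mul,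
        sum_ite_eq', mem_univ, if_true]
      field_simp
      ring
    rw [_root_.val, sum_filter, Fintype.sum_sum_type]
    simp only [Sum.elim_inl, Sum.elim_inr, hvb]
    by_cases ha : (a : ℕ) < n - 1
    · obtain ⟨b, rfl⟩ : ∃ b : Fin (n - 1), a = Fin.castLE (Nat.sub_le n 1) b := ⟨⟨a, ha⟩, rfl⟩
      have hne : (⟨n - 1, by omega⟩ : Fin n) ≠ Fin.castLE (Nat.sub_le n 1) b :=
        fun h => ha.ne' (congrArg Fin.val h)
      simp [hne]
    · have hlast : (⟨n - 1, by omega⟩ : Fin n) = a := Fin.ext (by dsimp only; omega)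
      have hne : ∀ b : Fin (n - 1), Fin.castLE (Nat.sub_le n 1) b ≠ a :=
        fun b h => ha (h ▸ b.isLt)
      simpa [hlast, hne] using hsmall
  · intro A hA hcard
    obtain ⟨i, hi⟩ := hA.exists_forall_inr_notMem (by omega)
    refine ⟨i, ?_⟩
    have hterm : ∀ x ∈ A i, v i x ≤ 1 + if x = Sum.inl i then ε else 0 := by
      rintro (j | j) hx
      · rw [hvs]
        have : 0 ≤ ε / ((n : ℝ) - 1) := by positivity
        by_cases hj : j = i
        · simp [hj]
        · simp [hj, this]
      · exact absurd hx (hi j)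
    have hc : ((A i).card : ℝ) ≤ 2 := by exact_mod_cast hcard i
    have hsum : ∑ x ∈ A i, (if x = Sum.inl i then ε else 0) ≤ ε := by
      rw [sum_ite_eq']
      split_ifs <;> linarith
    calc val (v i) (A i) ≤ ∑ x ∈ A i, (1 + if x = Sum.inl i then ε else 0) := sum_le_sum hterm
      _ = (A i).card + ∑ x ∈ A i, (if x = Sum.inl i then ε else 0) := by
        simp [sum_add_distrib]
      _ ≤ 2 + ε := add_le_add hc hsum
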